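/- Let n be an integer with 2 ≤ n ≤ 4 and let a, p₁, p₂, b be nonzero complex constants. Suppose f is an entire function satisfying f(z)ⁿ + a·(f'(z))ⁿ = p₁·e^{bz} + p₂·e^{−bz} for all z ∈ ℂ. Then n = 2 or n = 4 (in particular n ≠ 3), and: (i) if n = 4, then there exist complex constants k₁, k₂ such that f(z) = k₁e^{(b/2)z} + k₂e^{−(b/2)z} for all z, a·(b/2)⁴ = −1, 8k₁³k₂ = p₁ and 8k₂³k₁ = p₂; (ii) if n = 2 and 9ab² ≠ −4, then either ab² + 1 = 0 and there exist constants t₁, t₂, r with r⁴ = −p₁p₂, 2t₁r = p₁, 2t₂r = p₂ such that f(z) = t₁e^{bz} + t₂e^{−bz} + r for all z, or ab² − 4 = 0 and there exist constants l₁, l₂ with l₁² = p₁/2, l₂² = p₂/2 such that f(z) = l₁e^{(b/2)z} + l₂e^{−(b/2)z} for all z; (iii) if n = 2 and 9ab² = −4, then either there exist constants l₁, l₂ with l₂² = (9/8)p₁ and l₁² = p₂²/(8p₁) such that f(z) = l₁e^{−(3b/2)z} + l₂e^{(b/2)z} for all z, or there exist constants l₃, l₄ with l₄² = (9/8)p₂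 and l₃² = p₁²/(8p₂) such that f(z) = l₃e^{(3b/2)z} + l₄e^{−(b/2)z} for all z. -/

import Mathlib

open Complex

/-- Entire functions of exponential type (growth bound only). -/
def HasExpGrowth (g : ℂ → ℂ) : Prop :=
  ∃ A K : ℝ, 0 ≤ A ∧ 0 ≤ K ∧ ∀ z, ‖g z‖ ≤ A * Real.exp (K * ‖z‖)

namespace HasExpGrowth

variable {g h : ℂ → ℂ}

theorem mono (hg : HasExpGrowth g) (hle : ∀ z, ‖h z‖ ≤ ‖g z‖) : HasExpGrowth h := by
  obtain ⟨A, K, hA, hK, hb⟩ := hg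
  exact ⟨A, K, hA, hK, fun z => (hle z).trans (hb z)⟩

theorem const (c : ℂ) : HasExpGrowth fun _ => c :=
  ⟨‖c‖, 0, norm_nonneg _, le_rfl, fun z => by simp⟩

theorem add (hg : HasExpGrowth g) (hh : HasExpGrowth h) : HasExpGrowth fun z => g z + h z := by
  obtain ⟨A, K, hA, hK, hg⟩ := hg
  obtain ⟨B, L, hB, hL, hh⟩ := hh
  refine ⟨A + B, K + L, by positivity, by positivity, fun z => ?_⟩
  have h1 : Real.exp (K * ‖z‖) ≤ Real.exp ((K + L) * ‖z‖) :=
    Real.exp_le_exp.2 (by nlinarith [norm_nonneg z])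
  have h2 : Real.exp (L * ‖z‖) ≤ Real.exp ((K + L) * ‖z‖) :=
    Real.exp_le_exp.2 (by nlinarith [norm_nonneg z])
  calc ‖g z + h z‖ ≤ ‖g z‖ + ‖h z‖ := norm_add_le _ _
    _ ≤ A * Real.exp (K * ‖z‖) + B * Real.exp (L * ‖z‖) := add_le_add (hg z) (hh z)
    _ ≤ _ := by rw [add_mul]; gcongr

theorem mul (hg : HasExpGrowth g) (hh : HasExpGrowth h) : HasExpGrowth fun z => g z * h z := by
  obtain ⟨A, K, hA, hK, hg⟩ := hg
  obtain ⟨B, L, hB, hL, hh⟩ := hh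
  refine ⟨A * B, K + L, by positivity, by positivity, fun z => ?_⟩
  calc ‖g z * h z‖ = ‖g z‖ * ‖h z‖ := norm_mul _ _
    _ ≤ (A * Real.exp (K * ‖z‖)) * (B * Real.exp (L * ‖z‖)) := by gcongr <;> simp [hg, hh]
    _ = _ := by rw [add_mul, Real.exp_add]; ring

theorem const_mul (c : ℂ) (hg : HasExpGrowth g) : HasExpGrowth fun z => c * g z :=
  (const c).mul hg

theorem pow (hg : HasExpGrowth g) (n : ℕ) : HasExpGrowth fun z => g z ^ n := by
  induction n with
  | zero => simpa using const 1
  | succ n ih => simpa only [pow_succ] using ih.mul hg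

theorem exp_mul (c : ℂ) : HasExpGrowth fun z => exp (c * z) := by
  refine ⟨1, ‖c‖, zero_le_one, norm_nonneg _, fun z => ?_⟩
  rw [Complex.norm_exp, one_mul]
  exact Real.exp_le_exp.2 ((Complex.re_le_norm _).trans (norm_mul _ _).le)

theorem comp_add_bound (hg : HasExpGrowth g) :
    ∃ A K : ℝ, 0 ≤ A ∧ 0 ≤ K ∧ ∀ z w, ‖w - z‖ ≤ 1 → ‖g w‖ ≤ A * Real.exp (K * ‖z‖) := by
  obtain ⟨A, K, hA, hK, hb⟩ := hg
  refine ⟨A * Real.exp K, K, by positivity, hK, fun z w hw => (hb w).trans ?_⟩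
  rw [mul_assoc, ← Real.exp_add]
  have : ‖w‖ ≤ ‖z‖ + 1 := by
    have := norm_add_le (w - z) z
    rw [sub_add_cancel] at this
    linarith
  gcongr
  nlinarith

theorem deriv (hg : HasExpGrowth g) (hd : Differentiable ℂ g) : HasExpGrowth (deriv g) := by
  obtain ⟨A, K, hA, hK, hb⟩ := hg.comp_add_bound
  refine ⟨A, K, hA, hK, fun z => ?_⟩
  have := norm_deriv_le_of_forall_mem_sphere_norm_le (c := z) one_pos hd.diffContOnCl
    (C := A * Real.exp (K * ‖z‖)) (fun w hw => hb z w (by simpa using (mem_sphere_iff_norm.1 hw).le))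
  simpa using this

/-- Division by an exponential binomial preserves exponential growth. -/
theorem of_mul_exp_sub {q : ℂ} (hq : q ≠ 0) (hd : Differentiable ℂ g)
    (hg : HasExpGrowth fun z => g z * (exp (2 * z) - q)) : HasExpGrowth g := by
  obtain ⟨A, K, hA, hK, hb⟩ := hg.comp_add_bound
  have hq' : 0 < ‖q‖ := norm_pos_iff.2 hq
  refine ⟨A * (16 / ‖q‖), K, by positivity, hK, fun z => ?_⟩
  have key : ∀ w, ‖w - z‖ ≤ 1 → ‖q‖ / 16 ≤ ‖exp (2 * w) - q‖ →
      ‖g w‖ ≤ A * (16 / ‖q‖) * Real.exp (K * ‖z‖) := by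
    intro w hw hlow
    have h1 := hb z w hw
    rw [norm_mul] at h1
    have h2 : ‖g w‖ * (‖q‖ / 16) ≤ A * Real.exp (K * ‖z‖) :=
      (mul_le_mul_of_nonneg_left hlow (norm_nonneg _)).trans h1
    rw [← le_div_iff₀ (by positivity)] at h2
    refine h2.trans_eq ?_
    field_simp
  by_cases hz : ‖q‖ / 16 ≤ ‖exp (2 * z) - q‖
  · exact key z (by simp) hz
  push Not at hz
  refine norm_le_of_forall_mem_frontier_norm_le (U := Metric.ball z (1 / 4)) Metric.isBounded_ball
    hd.diffContOnCl (fun w hw => ?_) (subset_closure (Metric.mem_ball_self (by norm_num)))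
  rw [frontier_ball z (by norm_num), mem_sphere_iff_norm] at hw
  refine key w (by rw [hw]; norm_num) ?_
  set ζ := 2 * (w - z) with hζ
  have hζn : ‖ζ‖ = 1 / 2 := by rw [hζ, norm_mul, hw]; norm_num
  have e1 : ‖exp ζ - 1 - ζ‖ ≤ 1 / 4 := by
    refine (norm_exp_sub_one_sub_id_le (by rw [hζn]; norm_num)).trans ?_
    rw [hζn]; norm_num
  have e2 : (1 : ℝ) / 4 ≤ ‖exp ζ - 1‖ := by
    have := norm_sub_norm_le ζ (-(exp ζ - 1 - ζ))
    rw [norm_neg, hζn] at this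
    have h3 : ζ - -(exp ζ - 1 - ζ) = exp ζ - 1 := by ring
    rw [h3] at this
    linarith
  have e3 : ‖exp ζ‖ ≤ 2 := by
    have h4 : exp ζ = (exp ζ - 1 - ζ) + 1 + ζ := by ring
    rw [h4]
    refine (norm_add₃_le).trans ?_
    rw [hζn, norm_one]
    linarith
  have e4 : exp (2 * w) - q = q * (exp ζ - 1) - -((exp (2 * z) - q) * exp ζ) := by
    have : exp (2 * w) = exp (2 * z) * exp ζ := by rw [← Complex.exp_add, hζ]; ring_nf
    rw [this]; ring
  rw [e4]
  refine le_trans ?_ (norm_sub_norm_le _ _)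
  rw [norm_neg, norm_mul, norm_mul]
  have h5 : ‖exp (2 * z) - q‖ * ‖exp ζ‖ ≤ ‖q‖ / 16 * 2 := by gcongr
  have h6 : ‖q‖ * (1 / 4) ≤ ‖q‖ * ‖exp ζ - 1‖ := by gcongr
  linarith

end HasExpGrowth

/-- Logarithmic derivative estimate at the centre of a zero-free disc. -/
theorem norm_deriv_le_of_ne_zero_on_ball {g : ℂ → ℂ} (hg : Differentiable ℂ g) {c : ℂ} {r M : ℝ}
    (hr : 0 < r) (hM : 0 < M) (h0 : ∀ z ∈ Metric.ball c r, g z ≠ 0)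
    (hb : ∀ z ∈ Metric.ball c r, ‖g z‖ ≤ Real.exp M * ‖g c‖) :
    ‖deriv g c‖ ≤ 4 * M / r * ‖g c‖ := by
  have hcr : c ∈ Metric.ball c r := Metric.mem_ball_self hr
  have hgc : 0 < ‖g c‖ := norm_pos_iff.2 (h0 c hcr)
  have hd : DifferentiableOn ℂ (fun z => deriv g z / g z) (Metric.ball c r) :=
    hg.deriv.differentiableOn.div hg.differentiableOn h0
  obtain ⟨L, hL0, hL⟩ := hd.isExactOn_ball.with_val_at c 0
  have hexp : ∀ z ∈ Metric.ball c r, exp (-L z) * g z = g c := by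
    have hder : ∀ z ∈ Metric.ball c r, HasDerivAt (fun z => exp (-L z) * g z) 0 z := by
      intro z hz
      have := ((hL z hz).neg.cexp).mul (hg z).hasDerivAt
      refine this.congr_deriv ?_
      rw [mul_assoc, neg_mul, div_mul_cancel₀ _ (h0 z hz)]
      ring
    intro z hz
    have := (convex_ball c r).is_const_of_fderivWithin_eq_zero (𝕜 := ℂ)
      (f := fun z => exp (-L z) * g z)
      (fun w hw => (hder w hw).differentiableAt.differentiableWithinAt)
      (fun w hw => by
        rw [fderivWithin_of_isOpen Metric.isOpen_ball hw]
        have := (hder w hw).hasFDerivAt.fderiv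
        rw [this]; ext; simp) hz hcr
    simpa [hL0] using this
  have hre : ∀ z ∈ Metric.ball c r, (L z).re ≤ M := by
    intro z hz
    have h1 : ‖g z‖ = Real.exp (L z).re * ‖g c‖ := by
      rw [← hexp z hz, norm_mul, Complex.norm_exp, ← mul_assoc, ← Real.exp_add]
      simp
    have h2 := hb z hz
    rw [h1] at h2
    exact Real.exp_le_exp.1 (le_of_mul_le_mul_right h2 hgc)
  set F : ℂ → ℂ := fun w => L (c + w) with hF
  have hmem : ∀ w ∈ Metric.ball (0 : ℂ) r, c + w ∈ Metric.ball c r := by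
    intro w hw
    simpa [Metric.mem_ball, dist_eq_norm] using hw
  have hFd : ∀ w ∈ Metric.ball (0 : ℂ) r, HasDerivAt F (deriv g (c + w) / g (c + w)) w := by
    intro w hw
    exact (hL _ (hmem w hw)).comp_const_add c w
  have hFdiff : DifferentiableOn ℂ F (Metric.ball 0 r) :=
    fun w hw => (hFd w hw).differentiableAt.differentiableWithinAt
  have hr2 : 0 < r / 2 := by positivity
  have hsub : Metric.closedBall (0 : ℂ) (r / 2) ⊆ Metric.ball 0 r :=
    Metric.closedBall_subset_ball (by linarith)
  have hF' := norm_deriv_le_of_forall_mem_sphere_norm_le (c := (0 : ℂ)) (f := F) (C := 2 * M) hr2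
    ((hFdiff.mono (by rw [closure_ball _ hr2.ne']; exact hsub)).diffContOnCl) (by
      intro w hw
      have hw' : w ∈ Metric.ball (0 : ℂ) r := hsub (Metric.sphere_subset_closedBall hw)
      have := borelCaratheodory_zero hM hFdiff (fun x hx => hre _ (hmem x hx)) hr hw'
        (by simp [hF, hL0])
      have hwn : ‖w‖ = r / 2 := by simpa using hw
      rw [hwn] at this
      refine this.trans_eq ?_
      field_simp
      ring)
  rw [(hFd 0 (Metric.mem_ball_self hr)).deriv, add_zero, norm_div, div_le_iff₀ hgc] at hF'
  refine hF'.trans_eq ?_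
  field_simp
  ring

/-- An entire function of exponential growth that is bounded on the two diagonals is constant. -/
theorem eq_const_of_bounded_on_diagonals {H : ℂ → ℂ} (hH : Differentiable ℂ H)
    (hg : HasExpGrowth H) {M T : ℝ}
    (hb : ∀ z : ℂ, |z.re| = |z.im| → T ≤ |z.re| → ‖H z‖ ≤ M) (z w : ℂ) : H z = H w := by
  obtain ⟨C₀, hC₀⟩ := (isCompact_closedBall (0 : ℂ) (2 * T)).exists_bound_of_continuousOn
    hH.continuous.continuousOn
  set C := max M C₀
  have hC : ∀ z : ℂ, |z.re| = |z.im| → ‖H z‖ ≤ C := by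
    intro z hz
    by_cases hT : T ≤ |z.re|
    · exact (hb z hz hT).trans (le_max_left _ _)
    · refine (hC₀ z ?_).trans (le_max_right _ _)
      rw [mem_closedBall_zero_iff]
      have := Complex.norm_le_abs_re_add_abs_im z
      linarith
  set h : ℂ → ℂ := fun w => H ((1 + I) * w) with hh
  have hhd : Differentiable ℂ h := hH.comp (differentiable_id.const_mul _)
  obtain ⟨A, K, hA, hK, hgr⟩ := hg
  have hO : ∀ s : Set ℂ, ∃ c < (2 : ℝ), ∃ B,
      h =O[Bornology.cobounded ℂ ⊓ Filter.principal s] fun z => Real.exp (B * ‖z‖ ^ c) := by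
    intro s
    refine ⟨1, by norm_num, K * ‖(1 + I : ℂ)‖, Asymptotics.IsBigO.of_bound A ?_⟩
    refine Filter.Eventually.of_forall fun z => ?_
    rw [Real.rpow_one, Real.norm_eq_abs, Real.abs_exp]
    refine (hgr _).trans_eq ?_
    rw [norm_mul, mul_assoc]
  have hre : ∀ x : ℝ, ‖h x‖ ≤ C := fun x => hC _ (by simp)
  have him : ∀ x : ℝ, ‖h (x * I)‖ ≤ C := fun x => hC _ (by simp)
  have hbd : ∀ w, ‖h w‖ ≤ C := by
    intro w
    rcases le_total 0 w.re with h1 | h1 <;> rcases le_total 0 w.im with h2 | h2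
    · exact PhragmenLindelof.quadrant_I hhd.diffContOnCl (hO _) (fun x _ => hre x)
        (fun x _ => him x) h1 h2
    · exact PhragmenLindelof.quadrant_IV hhd.diffContOnCl (hO _) (fun x _ => hre x)
        (fun x _ => him x) h1 h2
    · exact PhragmenLindelof.quadrant_II hhd.diffContOnCl (hO _) (fun x _ => hre x)
        (fun x _ => him x) h1 h2
    · exact PhragmenLindelof.quadrant_III hhd.diffContOnCl (hO _) (fun x _ => hre x)
        (fun x _ => him x) h1 h2
  have hne : (1 + I : ℂ) ≠ 0 := by
    intro h
    have := congrArg Complex.re h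
    simp at this
  refine hH.apply_eq_apply_of_bounded ?_ z w
  rw [isBounded_iff_forall_norm_le]
  refine ⟨C, ?_⟩
  rintro _ ⟨u, rfl⟩
  have := hbd (u / (1 + I))
  simpa [hh, mul_div_cancel₀ _ hne] using this

/-- The quotient of entire functions is entire if the zeros of the denominator are simple and
are zeros of the numerator. -/
theorem exists_entire_quotient {g u : ℂ → ℂ} (hg : Differentiable ℂ g) (hu : Differentiable ℂ u)
    (hz : ∀ z, g z = 0 → u z = 0 ∧ deriv g z ≠ 0) :
    ∃ X : ℂ → ℂ, Differentiable ℂ X ∧ ∀ z, u z = X z * g z := by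
  classical
  set X : ℂ → ℂ := fun z => if g z = 0 then deriv u z / deriv g z else u z / g z with hX
  refine ⟨X, fun c => ?_, fun z => ?_⟩
  · by_cases hc : g c = 0
    · obtain ⟨huc, hgc⟩ := hz c hc
      have hdg : Differentiable ℂ (dslope g c) := by
        rw [← differentiableOn_univ, Complex.differentiableOn_dslope Filter.univ_mem]
        exact hg.differentiableOn
      have hdu : Differentiable ℂ (dslope u c) := by
        rw [← differentiableOn_univ, Complex.differentiableOn_dslope Filter.univ_mem]
        exact hu.differentiableOn
      have hne : dslope g c c ≠ 0 := by rwa [dslope_same]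
      refine ((hdu c).div (hdg c) hne).congr_of_eventuallyEq ?_
      filter_upwards [hdg.continuous.continuousAt.eventually_ne hne] with z hzne
      rcases eq_or_ne z c with rfl | hzc
      · simp [hX, hc, dslope_same]
      · have h1 : z - c ≠ 0 := sub_ne_zero.2 hzc
        simp only [Pi.div_apply]
        rw [dslope_of_ne _ hzc, slope_def_field, hc, sub_zero] at hzne
        rw [dslope_of_ne _ hzc, dslope_of_ne _ hzc, slope_def_field, slope_def_field, hc, huc,
          sub_zero, sub_zero]
        have h2 : g z ≠ 0 := fun h => hzne (by rw [h, zero_div])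
        simp only [hX, h2, if_false]
        field_simp
    · refine ((hu c).div (hg c) hc).congr_of_eventuallyEq ?_
      filter_upwards [hg.continuous.continuousAt.eventually_ne hc] with z hzne
      simp [hX, hzne]
  · by_cases hc : g z = 0
    · rw [hc, mul_zero, (hz z hc).1]
    · simp only [hX, hc, if_false]
      rw [div_mul_cancel₀ _ hc]

/-- Entire functions with vanishing Wronskian are proportional. -/
theorem exists_const_mul_of_wronskian_eq_zero {u v : ℂ → ℂ} (hu : Differentiable ℂ u)
    (hv : Differentiable ℂ v) {c : ℂ} (hc : v c ≠ 0)
    (hW : ∀ z, deriv u z * v z = u z * deriv v z) : ∃ C : ℂ, ∀ z, u z = C * v z := by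
  obtain ⟨r, hr, hball⟩ := Metric.eventually_nhds_iff_ball.1
    (hv.continuous.continuousAt.eventually_ne hc)
  have hder : ∀ z ∈ Metric.ball c r, HasDerivAt (fun z => u z / v z) 0 z := by
    intro z hz
    refine ((hu z).hasDerivAt.div (hv z).hasDerivAt (hball z hz)).congr_deriv ?_
    rw [hW, sub_self, zero_div]
  refine ⟨u c / v c, fun z => ?_⟩
  have hd' : Differentiable ℂ fun z => u c / v c * v z := hv.const_mul _
  refine congrFun (AnalyticOnNhd.eq_of_eventuallyEq (f := u) (g := fun z => u c / v c * v z) (z₀ := c)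
    (fun w _ => hu.analyticAt w) (fun w _ => hd'.analyticAt w) ?_) z
  filter_upwards [Metric.ball_mem_nhds c hr] with w hw
  have := (convex_ball c r).is_const_of_fderivWithin_eq_zero (𝕜 := ℂ)
    (f := fun z => u z / v z)
    (fun w hw => (hder w hw).differentiableAt.differentiableWithinAt)
    (fun w hw => by
      rw [fderivWithin_of_isOpen Metric.isOpen_ball hw, (hder w hw).hasFDerivAt.fderiv]
      ext; simp) hw (Metric.mem_ball_self hr)
  rw [← this, div_mul_cancel₀ _ (hball w hw)]

/-- A first-order estimate for `f'` extracted from the equation. -/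
theorem norm_deriv_le_of_pow_add_pow {n : ℕ} (hn : n ≠ 0) {a : ℂ} (ha : a ≠ 0) {x y G : ℂ}
    {B : ℝ} (hB : 1 ≤ B) (hG : ‖G‖ ≤ B) (h : x ^ n + a * y ^ n = G) :
    ‖y‖ ≤ (1 + ‖a‖⁻¹) * (‖x‖ + B) := by
  have ha' : 0 < ‖a‖ := norm_pos_iff.2 ha
  have h1 : ‖a‖ * ‖y‖ ^ n ≤ ‖x‖ ^ n + B := by
    have : a * y ^ n = G - x ^ n := by rw [← h]; ring
    calc ‖a‖ * ‖y‖ ^ n = ‖a * y ^ n‖ := by rw [norm_mul, norm_pow]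
      _ = ‖G - x ^ n‖ := by rw [this]
      _ ≤ ‖G‖ + ‖x ^ n‖ := norm_sub_le _ _
      _ ≤ _ := by rw [norm_pow]; linarith
  have h2 : ‖x‖ ^ n + B ≤ (‖x‖ + B) ^ n := by
    have h3 : ‖x‖ ^ n + B ^ n ≤ (‖x‖ + B) ^ n :=
      pow_add_pow_le (norm_nonneg _) (by linarith) hn
    have h4 : B ≤ B ^ n := le_self_pow₀ hB hn
    linarith
  refine le_of_pow_le_pow_left₀ hn (by positivity) ?_
  rw [mul_pow]
  have h5 : ‖a‖⁻¹ ≤ (1 + ‖a‖⁻¹) ^ n := by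
    have h6 : (1 : ℝ) ≤ 1 + ‖a‖⁻¹ := by linarith [inv_pos.2 ha']
    have := le_self_pow₀ h6 hn
    linarith
  calc ‖y‖ ^ n = ‖a‖⁻¹ * (‖a‖ * ‖y‖ ^ n) := by field_simp
    _ ≤ (1 + ‖a‖⁻¹) ^ n * (‖x‖ + B) ^ n := by gcongr; exact h1.trans h2

theorem norm_expBinomial_le (p₁ p₂ z : ℂ) :
    ‖p₁ * exp z + p₂ * exp (-z)‖ ≤ (1 + ‖p₁‖ + ‖p₂‖) * Real.exp ‖z‖ := by
  have h1 : ‖exp z‖ ≤ Real.exp ‖z‖ := by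
    rw [Complex.norm_exp]; exact Real.exp_le_exp.2 (Complex.re_le_norm z)
  have h2 : ‖exp (-z)‖ ≤ Real.exp ‖z‖ := by
    rw [Complex.norm_exp]
    exact Real.exp_le_exp.2 ((Complex.re_le_norm (-z)).trans (norm_neg z).le)
  calc _ ≤ ‖p₁‖ * ‖exp z‖ + ‖p₂‖ * ‖exp (-z)‖ := by
        rw [← norm_mul, ← norm_mul]; exact norm_add_le _ _
    _ ≤ ‖p₁‖ * Real.exp ‖z‖ + ‖p₂‖ * Real.exp ‖z‖ := by gcongr
    _ ≤ _ := by nlinarith [Real.exp_pos ‖z‖]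

theorem hasExpGrowth_of_eq {n : ℕ} (hn : n ≠ 0) {a p₁ p₂ : ℂ} (ha : a ≠ 0) {f : ℂ → ℂ}
    (hf : Differentiable ℂ f)
    (heq : ∀ z, f z ^ n + a * deriv f z ^ n = p₁ * exp z + p₂ * exp (-z)) : HasExpGrowth f := by
  set P : ℝ := 1 + ‖p₁‖ + ‖p₂‖ with hP
  have hP1 : 1 ≤ P := by have := norm_nonneg p₁; have := norm_nonneg p₂; linarith
  set D : ℝ := 1 + ‖a‖⁻¹ with hD
  have hD1 : 1 ≤ D := by have : 0 ≤ ‖a‖⁻¹ := by positivity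
                         linarith
  have hB1 : ∀ z : ℂ, 1 ≤ P * Real.exp ‖z‖ := fun z =>
    one_le_mul_of_one_le_of_one_le hP1 (Real.one_le_exp (norm_nonneg z))
  have hder : ∀ z, ‖deriv f z‖ ≤ D * (‖f z‖ + P * Real.exp ‖z‖) := fun z =>
    norm_deriv_le_of_pow_add_pow hn ha (hB1 z) (norm_expBinomial_le p₁ p₂ z) (heq z)
  refine ⟨‖f 0‖ + P, D + 1, by positivity, by positivity, fun z => ?_⟩
  rcases eq_or_ne z 0 with rfl | hz
  · simp; linarith
  have hz' : 0 < ‖z‖ := norm_pos_iff.2 hz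
  have hpath : ∀ s : ℝ, HasDerivAt (fun s : ℝ => f (s * z)) (deriv f (s * z) * z) s := by
    intro s
    have h1 : HasDerivAt (fun s : ℝ => (s : ℂ) * z) z s := by
      simpa using (Complex.ofRealCLM.hasDerivAt (x := s)).mul_const z
    exact (hf _).hasDerivAt.comp s h1
  have hK : D * ‖z‖ ≠ 0 := by positivity
  have := norm_le_gronwallBound_of_norm_deriv_right_le (f := fun s : ℝ => f (s * z))
    (f' := fun s => deriv f (s * z) * z) (δ := ‖f 0‖) (K := D * ‖z‖)
    (ε := D * ‖z‖ * (P * Real.exp ‖z‖)) (a := 0) (b := 1)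
    (fun s _ => (hpath s).continuousAt.continuousWithinAt)
    (fun s _ => (hpath s).hasDerivWithinAt) (by simp) (by
      intro s hs
      rw [norm_mul]
      have h1 := hder (s * z)
      have h2 : ‖(s : ℂ) * z‖ ≤ ‖z‖ := by
        rw [norm_mul, Complex.norm_real, Real.norm_of_nonneg hs.1]
        exact mul_le_of_le_one_left hz'.le hs.2.le
      have h3 : Real.exp ‖(s : ℂ) * z‖ ≤ Real.exp ‖z‖ := Real.exp_le_exp.2 h2
      calc ‖deriv f (s * z)‖ * ‖z‖ ≤ D * (‖f (s * z)‖ + P * Real.exp ‖(s : ℂ) * z‖) * ‖z‖ := by gcongr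
        _ ≤ D * (‖f (s * z)‖ + P * Real.exp ‖z‖) * ‖z‖ := by gcongr
        _ = _ := by ring) 1 (by simp)
  rw [gronwallBound_of_K_ne_0 hK] at this
  simp only [ofReal_one, one_mul, sub_zero, mul_one] at this
  refine this.trans ?_
  rw [mul_div_cancel_left₀ _ hK, add_mul D, one_mul, Real.exp_add]
  have e1 : 1 ≤ Real.exp ‖z‖ := Real.one_le_exp hz'.le
  have e2 := Real.exp_pos (D * ‖z‖)
  have e3 : Real.exp (D * ‖z‖) ≤ Real.exp (D * ‖z‖) * Real.exp ‖z‖ := le_mul_of_one_le_right e2.le e1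
  have e4 : ‖f 0‖ * Real.exp (D * ‖z‖) ≤ ‖f 0‖ * (Real.exp (D * ‖z‖) * Real.exp ‖z‖) := by gcongr
  have e5 : 0 ≤ P * Real.exp ‖z‖ := by positivity
  nlinarith

/-- The differentiated equation. -/
theorem deriv_eq_of_eq {m : ℕ} {a p₁ p₂ : ℂ} {f : ℂ → ℂ} (hf : Differentiable ℂ f)
    (heq : ∀ z, f z ^ (m + 2) + a * deriv f z ^ (m + 2) = p₁ * exp z + p₂ * exp (-z)) (z : ℂ) :
    (m + 2) * deriv f z * (f z ^ (m + 1) + a * deriv f z ^ m * deriv (deriv f) z)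
      = p₁ * exp z - p₂ * exp (-z) := by
  have h1 := ((hf z).hasDerivAt.pow (m + 2)).add
    (((hf.deriv z).hasDerivAt.pow (m + 2)).const_mul a)
  have h2 : HasDerivAt (fun z => p₁ * exp z + p₂ * exp (-z)) (p₁ * exp z + p₂ * (exp (-z) * -1)) z :=
    ((Complex.hasDerivAt_exp z).const_mul p₁).add ((hasDerivAt_neg z).cexp.const_mul p₂)
  have h3 := h1.unique (h2.congr_of_eventuallyEq (Filter.Eventually.of_forall heq))
  push_cast at h3
  rw [sub_eq_add_neg, ← mul_neg, ← mul_neg_one (exp (-z)), ← h3]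
  ring

theorem exists_expBinomial_real_bound {P Q : ℝ} (hP : 0 < P) (hQ : 0 ≤ Q) :
    ∃ R : ℝ, 1 ≤ R ∧ ∀ x, R ≤ x → 1 ≤ P * Real.exp x - Q * Real.exp (-x) ∧
      P * Real.exp x + Q * Real.exp (-x) ≤ 2 * (P * Real.exp x - Q * Real.exp (-x)) := by
  refine ⟨max 1 ((3 * Q + 1) / P), le_max_left _ _, fun x hx => ?_⟩
  have h1 : (1 : ℝ) ≤ x := (le_max_left _ _).trans hx
  have h2 : (3 * Q + 1) / P ≤ Real.exp x := by
    have := Real.add_one_le_exp x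
    have := (le_max_right 1 ((3 * Q + 1) / P)).trans hx
    linarith
  rw [div_le_iff₀ hP] at h2
  have h3 : Q * Real.exp (-x) ≤ Q := mul_le_of_le_one_right hQ (Real.exp_le_one_iff.2 (by linarith))
  constructor <;> nlinarith

theorem exists_expBinomial_bound {p₁ p₂ : ℂ} (hp₁ : p₁ ≠ 0) (hp₂ : p₂ ≠ 0) :
    ∃ R : ℝ, 1 ≤ R ∧ ∀ z : ℂ, R ≤ |z.re| → 1 ≤ ‖p₁ * exp z - p₂ * exp (-z)‖ ∧
      ‖p₁ * exp z + p₂ * exp (-z)‖ ≤ 2 * ‖p₁ * exp z - p₂ * exp (-z)‖ := by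
  obtain ⟨R₁, h1, hR₁⟩ := exists_expBinomial_real_bound (norm_pos_iff.2 hp₁) (norm_nonneg p₂)
  obtain ⟨R₂, h2, hR₂⟩ := exists_expBinomial_real_bound (norm_pos_iff.2 hp₂) (norm_nonneg p₁)
  refine ⟨max R₁ R₂, h1.trans (le_max_left _ _), fun z hz => ?_⟩
  have e1 : ‖p₁ * exp z‖ = ‖p₁‖ * Real.exp z.re := by rw [norm_mul, Complex.norm_exp]
  have e2 : ‖p₂ * exp (-z)‖ = ‖p₂‖ * Real.exp (-z.re) := by
    rw [norm_mul, Complex.norm_exp, neg_re]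
  have e3 := norm_add_le (p₁ * exp z) (p₂ * exp (-z))
  have e4 := norm_sub_norm_le (p₁ * exp z) (p₂ * exp (-z))
  have e5 := norm_sub_norm_le (p₂ * exp (-z)) (p₁ * exp z)
  rw [norm_sub_rev] at e5
  rw [e1, e2] at e3 e4 e5
  rcases abs_cases z.re with ⟨h, -⟩ | ⟨h, -⟩ <;> rw [h] at hz
  · have := hR₁ _ ((le_max_left _ _).trans hz)
    constructor <;> linarith
  · have := hR₂ _ ((le_max_right _ _).trans hz)
    rw [neg_neg] at this
    constructor <;> linarith

/-- On the diagonals, far from the origin, the derivative has no zeros and dominates both the function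
and its second derivative. -/
theorem exists_diagonal_bound {m : ℕ} {a p₁ p₂ : ℂ} (ha : a ≠ 0) (hp₁ : p₁ ≠ 0) (hp₂ : p₂ ≠ 0)
    {f : ℂ → ℂ} (hf : Differentiable ℂ f)
    (heq : ∀ z, f z ^ (m + 2) + a * deriv f z ^ (m + 2) = p₁ * exp z + p₂ * exp (-z)) :
    ∃ M T : ℝ, 0 ≤ M ∧ ∀ z : ℂ, |z.re| = |z.im| → T ≤ |z.re| →
      deriv f z ≠ 0 ∧ ‖deriv (deriv f) z‖ ≤ M * ‖deriv f z‖ ∧ ‖f z‖ ≤ M * ‖deriv f z‖ := by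
  have hfg := hasExpGrowth_of_eq (by omega) ha hf heq
  have hfg1 := hfg.deriv hf
  have hfg2 := hfg1.deriv hf.deriv
  have hk : HasExpGrowth fun z =>
      (m + 2) * (f z ^ (m + 1) + a * (deriv f z ^ m * deriv (deriv f) z)) :=
    ((hfg.pow _).add (((hfg1.pow _).mul hfg2).const_mul a)).const_mul _
  obtain ⟨A, K, hA, hK, hg⟩ := hfg1
  obtain ⟨B, L, hB, hL, hk⟩ := hk
  obtain ⟨R, hR1, hR⟩ := exists_expBinomial_bound hp₁ hp₂
  have hder := deriv_eq_of_eq hf heq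
  have hne : ∀ z : ℂ, R ≤ |z.re| → deriv f z ≠ 0 := by
    intro z hz h0
    have h1 := hder z
    rw [h0, mul_zero, zero_mul] at h1
    have h2 := (hR z hz).1
    rw [← h1, norm_zero] at h2
    linarith
  set N : ℝ := 8 * (A + B + 1 + 3 * K + 2 * L) with hN
  have hN0 : 0 ≤ N := by positivity
  set C : ℝ := 1 + ‖a‖ + 2 * (m + 2) * (1 + ‖a‖ * N) with hC
  have hC1 : 1 ≤ C := by
    have : 0 ≤ ‖a‖ + 2 * (m + 2) * (1 + ‖a‖ * N) := by positivity
    linarith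
  refine ⟨N + C, 2 * R, by positivity, fun z hdiag hz => ?_⟩
  set t := |z.re| with ht
  have ht1 : 1 ≤ t := by linarith
  have hy : 0 < ‖deriv f z‖ := norm_pos_iff.2 (hne z (by linarith))
  have hzn : ‖z‖ ≤ 2 * t := by
    have := Complex.norm_le_abs_re_add_abs_im z
    linarith
  have hα : ‖deriv (deriv f) z‖ ≤ N * ‖deriv f z‖ := by
    have h1 : 1 ≤ ‖deriv f z‖ * (B * Real.exp (L * (2 * t))) := by
      have h2 := (hR z (by linarith)).1
      have h3 : p₁ * exp z - p₂ * exp (-z) =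
          deriv f z * ((m + 2) * (f z ^ (m + 1) + a * (deriv f z ^ m * deriv (deriv f) z))) := by
        rw [← hder z]; ring
      rw [h3, norm_mul] at h2
      refine h2.trans ?_
      gcongr
      refine (hk z).trans ?_
      gcongr
    have hr : 0 < t / 2 := by linarith
    have hM : 0 < A + B + 1 + 3 * K * t + 2 * L * t := by positivity
    have hmem : ∀ w ∈ Metric.ball z (t / 2), R ≤ |w.re| ∧ ‖w‖ ≤ 3 * t := by
      intro w hw
      rw [mem_ball_iff_norm] at hw
      constructor
      · have h4 := Complex.abs_re_le_norm (w - z)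
        have h5 := abs_sub_abs_le_abs_sub z.re w.re
        rw [abs_sub_comm] at h5
        rw [sub_re] at h4
        linarith
      · have := norm_add_le (w - z) z
        rw [sub_add_cancel] at this
        linarith
    have h6 := norm_deriv_le_of_ne_zero_on_ball hf.deriv hr hM (fun w hw => hne w (hmem w hw).1) (by
      intro w hw
      have h7 : ‖deriv f w‖ ≤ A * Real.exp (K * (3 * t)) := by
        refine (hg w).trans ?_
        gcongr
        exact (hmem w hw).2
      have h8 : A ≤ Real.exp A := by linarith [Real.add_one_le_exp A]
      have h9 : B ≤ Real.exp B := by linarith [Real.add_one_le_exp B]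
      calc ‖deriv f w‖ ≤ A * Real.exp (K * (3 * t)) * 1 := by rw [mul_one]; exact h7
        _ ≤ A * Real.exp (K * (3 * t)) * (‖deriv f z‖ * (B * Real.exp (L * (2 * t)))) := by gcongr
        _ ≤ Real.exp A * Real.exp (K * (3 * t)) *
            (‖deriv f z‖ * (Real.exp B * Real.exp (L * (2 * t)))) := by gcongr
        _ = Real.exp (A + B + 3 * K * t + 2 * L * t) * ‖deriv f z‖ := by
          rw [show A + B + 3 * K * t + 2 * L * t = A + K * (3 * t) + B + L * (2 * t) by ring,
            Real.exp_add, Real.exp_add, Real.exp_add]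
          ring
        _ ≤ _ := mul_le_mul_of_nonneg_right (Real.exp_le_exp.2 (by linarith)) (norm_nonneg _))
    refine h6.trans ?_
    gcongr
    rw [div_le_iff₀ hr, hN]
    nlinarith
  refine ⟨norm_pos_iff.1 hy, hα.trans (by gcongr; linarith), ?_⟩
  suffices h : ‖f z‖ ≤ C * ‖deriv f z‖ from h.trans (by gcongr; linarith)
  by_contra! hlt
  set x := ‖f z‖
  set y := ‖deriv f z‖
  have hxy : y ≤ x := by nlinarith
  have hx : 0 < x := hy.trans_le hxy
  have h1 := (hR z (by linarith)).2
  rw [← heq z, ← hder z] at h1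
  have h2 : x ^ (m + 2) - ‖a‖ * y ^ (m + 2) ≤ ‖f z ^ (m + 2) + a * deriv f z ^ (m + 2)‖ := by
    have := norm_sub_norm_le (f z ^ (m + 2)) (-(a * deriv f z ^ (m + 2)))
    rw [sub_neg_eq_add, norm_neg, norm_mul, norm_pow, norm_pow] at this
    exact this
  have hm2 : ‖((m : ℂ) + 2)‖ = m + 2 := by
    rw [show (m : ℂ) + 2 = ((m + 2 : ℕ) : ℂ) by push_cast; ring, Complex.norm_natCast]
    push_cast; ring
  have h3 : ‖(m + 2) * deriv f z * (f z ^ (m + 1) + a * deriv f z ^ m * deriv (deriv f) z)‖ ≤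
      (m + 2) * y * (x ^ (m + 1) + ‖a‖ * y ^ m * (N * y)) := by
    rw [norm_mul, norm_mul, hm2]
    gcongr
    refine (norm_add_le _ _).trans ?_
    rw [norm_mul, norm_mul, norm_pow, norm_pow]
    gcongr
  have h4 : y ^ (m + 1) ≤ x ^ (m + 1) := by gcongr
  have h5 : x ^ (m + 1) * x ≤ x ^ (m + 1) * (C * y) := by
    have h6 : ‖a‖ * y ^ (m + 2) ≤ ‖a‖ * (y * x ^ (m + 1)) := by
      rw [pow_succ' y (m + 1)]; gcongr
    have h7 : (m + 2) * y * (x ^ (m + 1) + ‖a‖ * y ^ m * (N * y)) ≤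
        (m + 2) * y * (x ^ (m + 1) + ‖a‖ * N * x ^ (m + 1)) := by
      have : ‖a‖ * y ^ m * (N * y) = ‖a‖ * N * y ^ (m + 1) := by ring
      rw [this]; gcongr
    have h8 : x ^ (m + 2) = x ^ (m + 1) * x := pow_succ _ _
    have h9 : 0 ≤ x ^ (m + 1) * y := by positivity
    rw [hC]
    linarith
  have := le_of_mul_le_mul_left h5 (by positivity)
  linarith

/-- If the zeros of `f'` are simple zeros and also zeros of `u`, and `u` is dominated by `f'` on
the diagonals, then `u` is a constant multiple of `f'`. -/
theorem exists_eq_const_mul_deriv {m : ℕ} {a p₁ p₂ : ℂ} (hp₁ : p₁ ≠ 0) (hp₂ : p₂ ≠ 0)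
    (ha : a ≠ 0) {f u : ℂ → ℂ} (hf : Differentiable ℂ f) (hu : Differentiable ℂ u)
    (heq : ∀ z, f z ^ (m + 2) + a * deriv f z ^ (m + 2) = p₁ * exp z + p₂ * exp (-z))
    (hug : HasExpGrowth u) (hz : ∀ z, deriv f z = 0 → u z = 0 ∧ deriv (deriv f) z ≠ 0)
    {M T : ℝ} (hb : ∀ z : ℂ, |z.re| = |z.im| → T ≤ |z.re| →
      deriv f z ≠ 0 ∧ ‖u z‖ ≤ M * ‖deriv f z‖) :
    ∃ X : ℂ, ∀ z, u z = X * deriv f z := by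
  obtain ⟨X, hX, hXu⟩ := exists_entire_quotient hf.deriv hu hz
  have hfg := hasExpGrowth_of_eq (by omega) ha hf heq
  have hfg1 := hfg.deriv hf
  have hfg2 := hfg1.deriv hf.deriv
  have hXg : HasExpGrowth X := by
    refine HasExpGrowth.of_mul_exp_sub (q := p₂ / p₁) (div_ne_zero hp₂ hp₁) hX ?_
    have h1 : HasExpGrowth fun z => p₁⁻¹ * (m + 2) * (exp (1 * z) * (u z * (f z ^ (m + 1) +
        a * (deriv f z ^ m * deriv (deriv f) z)))) :=
      ((HasExpGrowth.exp_mul 1).mul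
        (hug.mul ((hfg.pow _).add (((hfg1.pow _).mul hfg2).const_mul a)))).const_mul _
    refine h1.mono fun z => le_of_eq (congrArg _ ?_)
    have h2 := deriv_eq_of_eq hf heq z
    have h3 : exp z * exp (-z) = 1 := by rw [← Complex.exp_add]; simp
    have h4 : exp (2 * z) = exp z * exp z := by rw [← Complex.exp_add]; ring_nf
    rw [hXu, one_mul, h4]
    have h5 : p₁⁻¹ * (m + 2) * (exp z * (X z * deriv f z * (f z ^ (m + 1) +
        a * (deriv f z ^ m * deriv (deriv f) z)))) = p₁⁻¹ * exp z * X z *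
        (p₁ * exp z - p₂ * exp (-z)) := by rw [← h2]; ring
    rw [h5]
    field_simp
    linear_combination X z * p₂ * h3
  refine ⟨X 0, fun z => ?_⟩
  rw [hXu, eq_const_of_bounded_on_diagonals hX hXg (M := M) (T := T) (fun w hd hT => ?_) z 0]
  obtain ⟨h0, h1⟩ := hb w hd hT
  rw [hXu, norm_mul] at h1
  exact le_of_mul_le_mul_right h1 (norm_pos_iff.2 h0)

theorem expBinomial_coeff_eq {A B C D : ℂ}
    (h : ∀ z, A * exp z + B * exp (-z) = C * exp z + D * exp (-z)) : A = C ∧ B = D := by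
  have h0 := h 0
  have h1 := h (Real.pi / 2 * I)
  rw [Complex.exp_neg, Complex.exp_pi_div_two_mul_I, Complex.inv_I] at h1
  simp only [neg_zero, Complex.exp_zero, mul_one] at h0
  have h2 : A - B = C - D := by
    linear_combination (-I) * h1 + (A - B - C + D) * Complex.I_sq
  constructor
  · linear_combination (h0 + h2) / 2
  · linear_combination (h0 - h2) / 2

theorem expBinomial_not_both_zero {p₁ p₂ z : ℂ} (hp₁ : p₁ ≠ 0)
    (h1 : p₁ * exp z + p₂ * exp (-z) = 0) (h2 : p₁ * exp z - p₂ * exp (-z) = 0) : False :=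
  mul_ne_zero hp₁ (Complex.exp_ne_zero z) (by linear_combination (h1 + h2) / 2)

theorem hasDerivAt_expBinomial_sub (p₁ p₂ z : ℂ) :
    HasDerivAt (fun z => p₁ * exp z - p₂ * exp (-z)) (p₁ * exp z + p₂ * exp (-z)) z := by
  refine (((Complex.hasDerivAt_exp z).const_mul p₁).sub
    ((hasDerivAt_neg z).cexp.const_mul p₂)).congr_deriv ?_
  ring

/-- The twice differentiated equation. -/
theorem deriv_deriv_eq_of_eq {m : ℕ} {a p₁ p₂ : ℂ} {f : ℂ → ℂ} (hf : Differentiable ℂ f)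
    (heq : ∀ z, f z ^ (m + 2) + a * deriv f z ^ (m + 2) = p₁ * exp z + p₂ * exp (-z)) (z : ℂ) :
    (m + 2) * (deriv (deriv f) z * (f z ^ (m + 1) + a * deriv f z ^ m * deriv (deriv f) z) +
      deriv f z * ((m + 1) * f z ^ m * deriv f z + a * (m * deriv f z ^ (m - 1) *
        deriv (deriv f) z ^ 2 + deriv f z ^ m * deriv (deriv (deriv f)) z)))
      = p₁ * exp z + p₂ * exp (-z) := by
  have d0 := (hf z).hasDerivAt
  have d1 := (hf.deriv z).hasDerivAt
  have d2 := (hf.deriv.deriv z).hasDerivAt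
  have h1 := (d1.const_mul ((m : ℂ) + 2)).mul
    ((d0.pow (m + 1)).add (((d1.pow m).const_mul a).mul d2))
  have h2 := h1.unique ((hasDerivAt_expBinomial_sub p₁ p₂ z).congr_of_eventuallyEq
    (Filter.Eventually.of_forall (deriv_eq_of_eq hf heq)))
  rw [← h2]
  simp only [Pi.add_apply, Pi.mul_apply, Pi.pow_apply]
  push_cast
  ring

theorem deriv_deriv_ne_zero {m : ℕ} {a p₁ p₂ : ℂ} (hp₁ : p₁ ≠ 0) {f : ℂ → ℂ}
    (hf : Differentiable ℂ f)
    (heq : ∀ z, f z ^ (m + 2) + a * deriv f z ^ (m + 2) = p₁ * exp z + p₂ * exp (-z)) {z : ℂ}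
    (hz : deriv f z = 0) : deriv (deriv f) z ≠ 0 := by
  intro h
  have h1 := deriv_eq_of_eq hf heq z
  have h2 := deriv_deriv_eq_of_eq hf heq z
  rw [hz, mul_zero, zero_mul] at h1
  rw [h, hz, zero_mul, zero_mul, add_zero, mul_zero] at h2
  exact expBinomial_not_both_zero hp₁ h2.symm h1.symm

/-- At a critical point, `n f'' = f` when `n ≥ 3`. -/
theorem deriv_deriv_eq_div {m : ℕ} {a p₁ p₂ : ℂ} (hp₁ : p₁ ≠ 0) {f : ℂ → ℂ} (hm : m ≠ 0)
    (hf : Differentiable ℂ f)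
    (heq : ∀ z, f z ^ (m + 2) + a * deriv f z ^ (m + 2) = p₁ * exp z + p₂ * exp (-z)) {z : ℂ}
    (hz : deriv f z = 0) : deriv (deriv f) z - f z / (m + 2) = 0 := by
  have h0 := heq z
  have h1 := deriv_eq_of_eq hf heq z
  have h2 := deriv_deriv_eq_of_eq hf heq z
  rw [hz, mul_zero, zero_mul] at h1
  rw [hz, zero_pow (by omega), mul_zero, add_zero] at h0
  rw [hz, zero_pow hm, ← h0] at h2
  have hfz : f z ≠ 0 := fun h => by
    rw [h, zero_pow (by omega)] at h0
    exact expBinomial_not_both_zero hp₁ h0.symm h1.symm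
  have hm2 : (m : ℂ) + 2 ≠ 0 := by exact_mod_cast (by omega : m + 2 ≠ 0)
  have h3 : f z ^ (m + 1) * ((m + 2) * deriv (deriv f) z - f z) = 0 := by
    linear_combination h2
  have h4 := (mul_eq_zero.1 h3).resolve_left (pow_ne_zero _ hfz)
  field_simp
  linear_combination h4

theorem eq_const_mul_exp_of_deriv_eq {A : ℂ → ℂ} (hA : Differentiable ℂ A) {r : ℂ}
    (h : ∀ z, deriv A z = r * A z) : ∃ C, ∀ z, A z = C * exp (r * z) := by
  have hd : ∀ z, HasDerivAt (fun z => exp (r * z)) (exp (r * z) * r) z := fun z => by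
    simpa using ((hasDerivAt_id z).const_mul r).cexp
  refine exists_const_mul_of_wronskian_eq_zero hA (fun z => (hd z).differentiableAt) (c := 0)
    (Complex.exp_ne_zero _) fun z => ?_
  rw [h, (hd z).deriv]; ring

theorem eq_add_exp_of_deriv_deriv_eq {f : ℂ → ℂ} (hf : Differentiable ℂ f) {r s : ℂ}
    (hrs : r ≠ s) (h : ∀ z, deriv (deriv f) z = (r + s) * deriv f z - r * s * f z) :
    ∃ k₁ k₂ : ℂ, ∀ z, f z = k₁ * exp (r * z) + k₂ * exp (s * z) := by
  have key : ∀ r s : ℂ, (∀ z, deriv (deriv f) z = (r + s) * deriv f z - r * s * f z) →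
      ∃ C, ∀ z, deriv f z - s * f z = C * exp (r * z) := by
    intro r s h
    refine eq_const_mul_exp_of_deriv_eq (A := fun z => deriv f z - s * f z)
      (hf.deriv.sub (hf.const_mul s)) fun z => ?_
    refine ((hf.deriv z).hasDerivAt.sub ((hf z).hasDerivAt.const_mul s)).deriv.trans ?_
    rw [h]
    ring
  obtain ⟨C, hC⟩ := key r s h
  obtain ⟨D, hD⟩ := key s r fun z => by rw [h]; ring
  have hrs' := sub_ne_zero.2 hrs
  refine ⟨C / (r - s), -D / (r - s), fun z => ?_⟩
  field_simp
  linear_combination hC z - hD z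

theorem eq_zero_of_eval_div_eq_zero {f g : ℂ → ℂ} (hf : Differentiable ℂ f)
    (hg : Differentiable ℂ g) {c : ℂ} (hc : g c ≠ 0) (hfg : ¬ ∃ k, ∀ z, f z = k * g z)
    (P : Polynomial ℂ) (hP : ∀ z, g z ≠ 0 → P.eval (f z / g z) = 0) : P = 0 := by
  by_contra hP0
  obtain ⟨r, hr, hball⟩ := Metric.eventually_nhds_iff_ball.1
    (hg.continuous.continuousAt.eventually_ne hc)
  have hpre : IsPreconnected ((fun z => f z / g z) '' Metric.ball c r) :=
    (convex_ball c r).isPreconnected.image _ fun z hz =>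
      ((hf z).continuousAt.div (hg z).continuousAt (hball z hz)).continuousWithinAt
  have hfin : ((fun z => f z / g z) '' Metric.ball c r).Finite := by
    refine (P.roots.toFinset.finite_toSet).subset ?_
    rintro _ ⟨z, hz, rfl⟩
    simpa [hP0] using hP z (hball z hz)
  have hsub : ((fun z => f z / g z) '' Metric.ball c r).Subsingleton := by
    by_contra h
    exact hpre.infinite_of_nontrivial (Set.not_subsingleton_iff.1 h) hfin
  have hd' : Differentiable ℂ fun z => f c / g c * g z := hg.const_mul _
  refine hfg ⟨f c / g c, fun z => ?_⟩
  refine congrFun (AnalyticOnNhd.eq_of_eventuallyEq (f := f) (g := fun z => f c / g c * g z)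
    (z₀ := c) (fun w _ => hf.analyticAt w) (fun w _ => hd'.analyticAt w) ?_) z
  filter_upwards [Metric.ball_mem_nhds c hr] with w hw
  have := hsub (Set.mem_image_of_mem _ (Metric.mem_ball_self hr)) (Set.mem_image_of_mem _ hw)
  rw [show f c / g c = f w / g w from this, div_mul_cancel₀ _ (hball w hw)]

theorem coeff_eq_zero_of_not_proportional {f g : ℂ → ℂ} (hf : Differentiable ℂ f)
    (hg : Differentiable ℂ g) {c : ℂ} (hc : g c ≠ 0) (hfg : ¬ ∃ k, ∀ z, f z = k * g z)
    {c₀ c₁ c₂ c₃ : ℂ} (h : ∀ z, g z ≠ 0 →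
      c₀ * g z ^ 3 + c₁ * f z * g z ^ 2 + c₂ * f z ^ 2 * g z + c₃ * f z ^ 3 = 0) :
    c₀ = 0 ∧ c₁ = 0 ∧ c₂ = 0 ∧ c₃ = 0 := by
  have hP := eq_zero_of_eval_div_eq_zero hf hg hc hfg
    (.C c₀ + .C c₁ * .X + .C c₂ * .X ^ 2 + .C c₃ * .X ^ 3) fun z hz => by
      simp only [Polynomial.eval_add, Polynomial.eval_mul, Polynomial.eval_C, Polynomial.eval_X,
        Polynomial.eval_pow]
      field_simp
      linear_combination h z hz
  have e : ∀ n, _ := fun n => congrArg (Polynomial.coeff · n) hP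
  have e0 := e 0
  have e1 := e 1
  have e2 := e 2
  have e3 := e 3
  simp [Polynomial.coeff_X, Polynomial.coeff_C] at e0 e1 e2 e3
  exact ⟨e0, e1, e2, e3⟩

theorem not_deriv_eq_const_mul {m : ℕ} {a p₁ p₂ : ℂ} (hp₁ : p₁ ≠ 0) (hp₂ : p₂ ≠ 0) {f : ℂ → ℂ}
    (hf : Differentiable ℂ f)
    (heq : ∀ z, f z ^ (m + 2) + a * deriv f z ^ (m + 2) = p₁ * exp z + p₂ * exp (-z)) (k : ℂ)
    (h : ∀ z, deriv f z = k * f z) : False := by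
  have h2 : ∀ z, deriv (deriv f) z = k * (k * f z) := fun z => by
    rw [funext h, ((hf z).hasDerivAt.const_mul k).deriv, h]
  have h3 : ∀ z, p₁ * exp z + -p₂ * exp (-z) =
      (m + 2) * k * p₁ * exp z + (m + 2) * k * p₂ * exp (-z) := fun z => by
    have e0 := heq z
    have e1 := deriv_eq_of_eq hf heq z
    rw [h2, h] at e1
    rw [h] at e0
    linear_combination -e1 + (m + 2) * k * e0
  obtain ⟨e1, e2⟩ := expBinomial_coeff_eq h3
  have e3 : (m + 2) * k = 1 := mul_right_cancel₀ hp₁ (by linear_combination -e1)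
  rw [e3, one_mul] at e2
  exact hp₂ (by linear_combination -e2 / 2)

theorem not_eq_const_mul_deriv {m : ℕ} {a p₁ p₂ : ℂ} (hp₁ : p₁ ≠ 0) (hp₂ : p₂ ≠ 0) {f : ℂ → ℂ}
    (hf : Differentiable ℂ f)
    (heq : ∀ z, f z ^ (m + 2) + a * deriv f z ^ (m + 2) = p₁ * exp z + p₂ * exp (-z)) :
    ¬ ∃ k, ∀ z, f z = k * deriv f z := by
  rintro ⟨k, hk⟩
  rcases eq_or_ne k 0 with rfl | hk0
  · have h0 : f = fun _ => 0 := funext fun z => by rw [hk, zero_mul]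
    exact not_deriv_eq_const_mul hp₁ hp₂ hf heq 0 fun z => by rw [h0]; simp
  · refine not_deriv_eq_const_mul hp₁ hp₂ hf heq k⁻¹ fun z => ?_
    rw [hk z, inv_mul_cancel_left₀ hk0]

theorem exists_deriv_ne_zero {m : ℕ} {a p₁ p₂ : ℂ} (hp₁ : p₁ ≠ 0) (hp₂ : p₂ ≠ 0) {f : ℂ → ℂ}
    (hf : Differentiable ℂ f)
    (heq : ∀ z, f z ^ (m + 2) + a * deriv f z ^ (m + 2) = p₁ * exp z + p₂ * exp (-z)) :
    ∃ c, deriv f c ≠ 0 := by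
  by_contra! h
  exact not_deriv_eq_const_mul hp₁ hp₂ hf heq 0 fun z => by rw [h, zero_mul]

/-- For `n ≥ 3` the solution satisfies a linear equation of second order. -/
theorem exists_deriv_deriv_eq {m : ℕ} (hm : m ≠ 0) {a p₁ p₂ : ℂ} (ha : a ≠ 0) (hp₁ : p₁ ≠ 0)
    (hp₂ : p₂ ≠ 0) {f : ℂ → ℂ} (hf : Differentiable ℂ f)
    (heq : ∀ z, f z ^ (m + 2) + a * deriv f z ^ (m + 2) = p₁ * exp z + p₂ * exp (-z)) :
    ∃ X : ℂ, (∀ z, deriv (deriv f) z = X * deriv f z + f z / (m + 2)) ∧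
      ∀ z, deriv (deriv (deriv f)) z = X * deriv (deriv f) z + deriv f z / (m + 2) := by
  obtain ⟨M, T, hM, hb⟩ := exists_diagonal_bound ha hp₁ hp₂ hf heq
  have hfg := hasExpGrowth_of_eq (by omega) ha hf heq
  obtain ⟨X, hX⟩ := exists_eq_const_mul_deriv (M := M + M * ‖(-((m : ℂ) + 2)⁻¹)‖) (T := T)
    (u := fun z => deriv (deriv f) z + -((m : ℂ) + 2)⁻¹ * f z) hp₁ hp₂ ha hf
    (hf.deriv.deriv.add (hf.const_mul _)) heq
    (((hfg.deriv hf).deriv hf.deriv).add (hfg.const_mul _))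
    (fun z hz => ⟨by linear_combination deriv_deriv_eq_div hp₁ hm hf heq hz,
      deriv_deriv_ne_zero hp₁ hf heq hz⟩)
    (fun z h1 h2 => by
      obtain ⟨e1, e2, e3⟩ := hb z h1 h2
      refine ⟨e1, (norm_add_le _ _).trans ?_⟩
      rw [norm_mul, add_mul, mul_comm M ‖-((m : ℂ) + 2)⁻¹‖, mul_assoc ‖-((m : ℂ) + 2)⁻¹‖]
      gcongr)
  have hX2 : ∀ z, deriv (deriv f) z = X * deriv f z + f z / (m + 2) := fun z => by
    linear_combination hX z
  refine ⟨X, hX2, fun z => ?_⟩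
  exact ((((hf.deriv z).hasDerivAt.const_mul X).add
    ((hf z).hasDerivAt.div_const _)).congr_of_eventuallyEq (Filter.Eventually.of_forall hX2)).deriv

theorem exp_eq_exp_half_sq (z : ℂ) : exp z = exp (1 / 2 * z) ^ 2 := by
  rw [← Complex.exp_nat_mul]; push_cast; ring_nf

theorem exp_half_mul_exp_neg_half (z : ℂ) : exp (1 / 2 * z) * exp (-(1 / 2) * z) = 1 := by
  rw [← Complex.exp_add]; ring_nf; exact Complex.exp_zero

theorem hasDerivAt_add_exp (k₁ k₂ r s z : ℂ) :
    HasDerivAt (fun z => k₁ * exp (r * z) + k₂ * exp (s * z))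
      (k₁ * (r * exp (r * z)) + k₂ * (s * exp (s * z))) z := by
  have h : ∀ r : ℂ, HasDerivAt (fun z => exp (r * z)) (r * exp (r * z)) z := fun r => by
    simpa [mul_comm] using ((hasDerivAt_id z).const_mul r).cexp
  exact ((h r).const_mul k₁).add ((h s).const_mul k₂)

theorem not_cubic_solution {a p₁ p₂ : ℂ} (ha : a ≠ 0) (hp₁ : p₁ ≠ 0) (hp₂ : p₂ ≠ 0) {f : ℂ → ℂ}
    (hf : Differentiable ℂ f)
    (heq : ∀ z, f z ^ 3 + a * deriv f z ^ 3 = p₁ * exp z + p₂ * exp (-z)) : False := by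
  obtain ⟨X, hX, hX3⟩ := exists_deriv_deriv_eq (m := 1) one_ne_zero ha hp₁ hp₂ hf heq
  obtain ⟨c, hc⟩ := exists_deriv_ne_zero (m := 1) hp₁ hp₂ hf heq
  obtain ⟨e0, e1, -⟩ := coeff_eq_zero_of_not_proportional hf hf.deriv hc
    (not_eq_const_mul_deriv (m := 1) hp₁ hp₂ hf heq)
    (c₀ := 9 * a * X ^ 2) (c₁ := 6 + 5 * a * X) (c₂ := 3 * X + 2 * a / 3) (c₃ := 0)
    fun z _ => by
      have h2 := deriv_deriv_eq_of_eq (m := 1) hf heq z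
      rw [← heq, hX3, hX] at h2
      push_cast at h2
      linear_combination h2
  obtain rfl : X = 0 := by simpa [ha] using e0
  norm_num at e1

theorem quartic_solution {a p₁ p₂ : ℂ} (ha : a ≠ 0) (hp₁ : p₁ ≠ 0) (hp₂ : p₂ ≠ 0) {f : ℂ → ℂ}
    (hf : Differentiable ℂ f)
    (heq : ∀ z, f z ^ 4 + a * deriv f z ^ 4 = p₁ * exp z + p₂ * exp (-z)) :
    a = -16 ∧ ∃ k₁ k₂ : ℂ, (∀ z, f z = k₁ * exp (1 / 2 * z) + k₂ * exp (-(1 / 2) * z)) ∧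
      8 * k₁ ^ 3 * k₂ = p₁ ∧ 8 * k₂ ^ 3 * k₁ = p₂ := by
  obtain ⟨X, hX, hX3⟩ := exists_deriv_deriv_eq (m := 2) two_ne_zero ha hp₁ hp₂ hf heq
  obtain ⟨c, hc⟩ := exists_deriv_ne_zero (m := 2) hp₁ hp₂ hf heq
  obtain ⟨e0, -, e2, -⟩ := coeff_eq_zero_of_not_proportional hf hf.deriv hc
    (not_eq_const_mul_deriv (m := 2) hp₁ hp₂ hf heq)
    (c₀ := 16 * a * X ^ 2) (c₁ := 7 * a * X) (c₂ := 12 + 3 * a / 4) (c₃ := 4 * X)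
    fun z hz => by
      have h2 := deriv_deriv_eq_of_eq (m := 2) hf heq z
      rw [← heq, hX3, hX] at h2
      push_cast at h2
      refine mul_left_cancel₀ hz ?_
      linear_combination h2
  obtain rfl : X = 0 := by simpa [ha] using e0
  obtain rfl : a = -16 := by linear_combination 4 / 3 * e2
  obtain ⟨k₁, k₂, hk⟩ := eq_add_exp_of_deriv_deriv_eq hf (r := 1 / 2) (s := -(1 / 2))
    (by norm_num) fun z => by rw [hX]; push_cast; ring
  refine ⟨rfl, k₁, k₂, hk, expBinomial_coeff_eq fun z => ?_⟩
  rw [← heq, funext hk, (hasDerivAt_add_exp _ _ _ _ _).deriv, exp_eq_exp_half_sq z,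
    exp_eq_exp_half_sq (-z), show (1 / 2 * -z : ℂ) = -(1 / 2) * z by ring]
  linear_combination (-8 * (k₁ ^ 3 * k₂ * exp (1 / 2 * z) ^ 2
    + k₁ * k₂ ^ 3 * exp (-(1 / 2) * z) ^ 2)) * exp_half_mul_exp_neg_half z

theorem quadratic_ode {a p₁ p₂ : ℂ} {f : ℂ → ℂ} (hf : Differentiable ℂ f)
    (heq : ∀ z, f z ^ 2 + a * deriv f z ^ 2 = p₁ * exp z + p₂ * exp (-z)) (z : ℂ) :
    2 * deriv f z ^ 2 + 2 * f z * deriv (deriv f) z + 2 * a * deriv (deriv f) z ^ 2 +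
      2 * a * deriv f z * deriv (deriv (deriv f)) z = f z ^ 2 + a * deriv f z ^ 2 := by
  have h := deriv_deriv_eq_of_eq (m := 0) hf heq z
  rw [← heq] at h
  push_cast at h
  linear_combination h

/-- Away from the exceptional value `9a = -4`, the third derivative vanishes at critical points. -/
theorem deriv_deriv_deriv_eq_zero {a p₁ p₂ : ℂ} (ha : a ≠ 0) (h9 : 9 * a ≠ -4) (hp₁ : p₁ ≠ 0)
    {f : ℂ → ℂ} (hf : Differentiable ℂ f)
    (heq : ∀ z, f z ^ 2 + a * deriv f z ^ 2 = p₁ * exp z + p₂ * exp (-z)) {z : ℂ}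
    (hz : deriv f z = 0) : deriv (deriv (deriv f)) z = 0 := by
  have d0 := (hf z).hasDerivAt
  have d1 := (hf.deriv z).hasDerivAt
  have d2 := (hf.deriv.deriv z).hasDerivAt
  have d3 := (hf.deriv.deriv.deriv z).hasDerivAt
  have h1 := ((((d1.pow 2).const_mul 2).add ((d0.const_mul 2).mul d2)).add
    ((d2.pow 2).const_mul (2 * a))).add ((d1.const_mul (2 * a)).mul d3)
  have h2 := h1.unique (((d0.pow 2).add ((d1.pow 2).const_mul a)).congr_of_eventuallyEq
    (Filter.Eventually.of_forall (quadratic_ode hf heq)))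
  have h3 := quadratic_ode hf heq z
  have h4 := deriv_deriv_ne_zero (m := 0) hp₁ hf heq hz
  norm_num [hz] at h2 h3
  by_contra h
  have h5 : f z + 3 * a * deriv (deriv f) z = 0 := by
    refine (mul_eq_zero.1 (?_ : deriv (deriv (deriv f)) z * _ = 0)).resolve_left h
    linear_combination h2 / 2
  refine h9 ?_
  refine mul_left_cancel₀ (mul_ne_zero ha (pow_ne_zero 2 h4)) ?_
  linear_combination -h3 + (2 * deriv (deriv f) z - f z + 3 * a * deriv (deriv f) z) * h5

theorem exists_deriv_deriv_deriv_eq {a p₁ p₂ : ℂ} (ha : a ≠ 0) (h9 : 9 * a ≠ -4) (hp₁ : p₁ ≠ 0)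
    (hp₂ : p₂ ≠ 0) {f : ℂ → ℂ} (hf : Differentiable ℂ f)
    (heq : ∀ z, f z ^ 2 + a * deriv f z ^ 2 = p₁ * exp z + p₂ * exp (-z)) :
    ∃ ν : ℂ, ∀ z, deriv (deriv (deriv f)) z = ν * deriv f z := by
  obtain ⟨M, T, hM, hb⟩ := exists_diagonal_bound (m := 0) ha hp₁ hp₂ hf heq
  have hfg := hasExpGrowth_of_eq two_ne_zero ha hf heq
  have ha' : 0 < ‖a‖ := norm_pos_iff.2 ha
  refine exists_eq_const_mul_deriv (m := 0)
    (M := (M ^ 2 + (‖a‖ + 2) + 2 * M ^ 2 + 2 * ‖a‖ * M ^ 2) / (2 * ‖a‖)) (T := T)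
    hp₁ hp₂ ha hf hf.deriv.deriv.deriv heq
    (((hfg.deriv hf).deriv hf.deriv).deriv hf.deriv.deriv)
    (fun z hz => ⟨deriv_deriv_deriv_eq_zero ha h9 hp₁ hf heq hz,
      deriv_deriv_ne_zero (m := 0) hp₁ hf heq hz⟩)
    (fun z h1 h2 => ?_)
  obtain ⟨e1, e2, e3⟩ := hb z h1 h2
  refine ⟨e1, ?_⟩
  have e0 : 0 < ‖deriv f z‖ := norm_pos_iff.2 e1
  have h3 : 2 * a * deriv f z * deriv (deriv (deriv f)) z = f z ^ 2 + (a - 2) * deriv f z ^ 2 -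
      2 * f z * deriv (deriv f) z - 2 * a * deriv (deriv f) z ^ 2 := by
    linear_combination quadratic_ode hf heq z
  have h4 : 2 * ‖a‖ * ‖deriv f z‖ * ‖deriv (deriv (deriv f)) z‖ ≤
      (M * ‖deriv f z‖) ^ 2 + (‖a‖ + 2) * ‖deriv f z‖ ^ 2 +
      2 * (M * ‖deriv f z‖) * (M * ‖deriv f z‖) + 2 * ‖a‖ * (M * ‖deriv f z‖) ^ 2 := by
    calc _ = ‖2 * a * deriv f z * deriv (deriv (deriv f)) z‖ := by simp
      _ ≤ ‖f z ^ 2‖ + ‖(a - 2) * deriv f z ^ 2‖ + ‖2 * f z * deriv (deriv f) z‖ +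
          ‖2 * a * deriv (deriv f) z ^ 2‖ := by
        rw [h3]
        exact (norm_sub_le _ _).trans (add_le_add_left ((norm_sub_le _ _).trans
          (add_le_add_left (norm_add_le _ _) _)) _)
      _ ≤ _ := by
        simp only [norm_mul, norm_pow, Complex.norm_ofNat]
        have : ‖a - 2‖ ≤ ‖a‖ + 2 := (norm_sub_le _ _).trans (by simp)
        gcongr
  rw [div_mul_eq_mul_div, le_div_iff₀ (by positivity)]
  refine le_of_mul_le_mul_left ?_ e0
  linarith

theorem exists_eq_const {h : ℂ → ℂ} (hd : ∀ z, HasDerivAt h 0 z) : ∃ κ, ∀ z, h z = κ :=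
  ⟨h 0, fun z => is_const_of_deriv_eq_zero (fun z => (hd z).differentiableAt)
    (fun z => (hd z).deriv) z 0⟩

theorem not_deriv_sq_eq_const_mul {m : ℕ} {a p₁ p₂ : ℂ} (hp₁ : p₁ ≠ 0) (hp₂ : p₂ ≠ 0) {f : ℂ → ℂ}
    (hf : Differentiable ℂ f)
    (heq : ∀ z, f z ^ (m + 2) + a * deriv f z ^ (m + 2) = p₁ * exp z + p₂ * exp (-z)) (ν : ℂ)
    (h : ∀ z, deriv f z ^ 2 = ν * f z ^ 2) : False := by
  obtain ⟨c, hc⟩ := exists_deriv_ne_zero hp₁ hp₂ hf heq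
  obtain ⟨e0, -⟩ := coeff_eq_zero_of_not_proportional hf hf.deriv hc
    (not_eq_const_mul_deriv hp₁ hp₂ hf heq) (c₀ := 1) (c₁ := 0) (c₂ := -ν) (c₃ := 0)
    fun z _ => by linear_combination deriv f z * h z
  exact one_ne_zero e0

theorem quadratic_solution {a p₁ p₂ : ℂ} (ha : a ≠ 0) (h9 : 9 * a ≠ -4) (hp₁ : p₁ ≠ 0)
    (hp₂ : p₂ ≠ 0) {f : ℂ → ℂ} (hf : Differentiable ℂ f)
    (heq : ∀ z, f z ^ 2 + a * deriv f z ^ 2 = p₁ * exp z + p₂ * exp (-z)) :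
    (a = -1 ∧ ∃ t₁ t₂ r : ℂ, r ^ 4 = -(p₁ * p₂) ∧ 2 * t₁ * r = p₁ ∧ 2 * t₂ * r = p₂ ∧
      ∀ z, f z = t₁ * exp z + t₂ * exp (-z) + r) ∨
    (a = 4 ∧ ∃ l₁ l₂ : ℂ, l₁ ^ 2 = p₁ / 2 ∧ l₂ ^ 2 = p₂ / 2 ∧
      ∀ z, f z = l₁ * exp (1 / 2 * z) + l₂ * exp (-(1 / 2) * z)) := by
  obtain ⟨ν, hν⟩ := exists_deriv_deriv_deriv_eq ha h9 hp₁ hp₂ hf heq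
  have d0 := fun z => (hf z).hasDerivAt
  have d1 := fun z => (hf.deriv z).hasDerivAt
  have d2 := fun z => (hf.deriv.deriv z).hasDerivAt
  obtain ⟨κ, hκ⟩ := exists_eq_const (h := fun z => deriv (deriv f) z - ν * f z) fun z =>
    ((d2 z).sub ((d0 z).const_mul ν)).congr_deriv (by rw [hν, sub_self])
  have hκ' : ∀ z, deriv (deriv f) z = ν * f z + κ := fun z => by linear_combination hκ z
  obtain ⟨C, hC⟩ := exists_eq_const (h := fun z => deriv f z ^ 2 - ν * f z ^ 2 - 2 * κ * f z)
    fun z => ((((d1 z).pow 2).sub (((d0 z).pow 2).const_mul ν)).sub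
      ((d0 z).const_mul (2 * κ))).congr_deriv (by push_cast; rw [hκ']; ring)
  have hC' : ∀ z, deriv f z ^ 2 = ν * f z ^ 2 + 2 * κ * f z + C := fun z => by
    linear_combination hC z
  have hnc : ¬ ∃ k, ∀ z, f z = k * (fun _ => (1 : ℂ)) z := by
    rintro ⟨k, hk⟩
    refine not_deriv_eq_const_mul (m := 0) hp₁ hp₂ hf heq 0 fun z => ?_
    rw [show f = fun _ => k from funext fun z => by rw [hk, mul_one]]
    simp
  obtain ⟨e0, e1, e2, -⟩ := coeff_eq_zero_of_not_proportional hf (differentiable_const 1)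
    (c := 0) one_ne_zero hnc (c₀ := C * (2 + 2 * a * ν - a) + 2 * a * κ ^ 2)
    (c₁ := κ * (6 + 8 * a * ν - 2 * a)) (c₂ := (a * ν + 1) * (4 * ν - 1)) (c₃ := 0) fun z _ => by
      have h := quadratic_ode hf heq z
      rw [hν, hκ'] at h
      linear_combination h - (2 + 2 * a * ν - a) * hC' z
  have hC0 : κ = 0 → C ≠ 0 := fun h1 h2 =>
    not_deriv_sq_eq_const_mul (m := 0) hp₁ hp₂ hf heq ν fun z => by rw [hC', h1, h2]; ring
  rcases mul_eq_zero.1 e2 with h | h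
  · have hκ0 : κ ≠ 0 := fun h1 => by
      refine hC0 h1 (mul_left_cancel₀ ha ?_)
      rw [h1] at e0
      linear_combination -e0 + 2 * C * h
    obtain rfl : a = -1 := by
      have := (mul_eq_zero.1 e1).resolve_left hκ0
      linear_combination -this / 2 + 4 * h
    obtain rfl : ν = 1 := by linear_combination -h
    refine .inl ⟨rfl, ?_⟩
    obtain ⟨k₁, k₂, hk⟩ := eq_add_exp_of_deriv_deriv_eq (f := fun z => f z + κ)
      (hf.add_const κ) (r := 1) (s := -1) (by norm_num) fun z => by
        simp only [deriv_add_const']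
        rw [hκ']; ring
    have hE : ∀ z, exp (1 * z) * exp (-1 * z) = 1 := fun z => by
      rw [← Complex.exp_add]; ring_nf; exact Complex.exp_zero
    have hfk : ∀ z, f z = k₁ * exp (1 * z) + k₂ * exp (-1 * z) + -κ := fun z => by
      linear_combination hk z
    have hdk : ∀ z, deriv f z = k₁ * (1 * exp (1 * z)) + k₂ * (-1 * exp (-1 * z)) := fun z => by
      rw [funext hfk]
      exact ((hasDerivAt_add_exp k₁ k₂ 1 (-1) z).add_const _).deriv
    have hkk : 4 * k₁ * k₂ = -κ ^ 2 := by
      have h1 := hC' 0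
      rw [hfk, hdk] at h1
      have h2 := hE 0
      linear_combination -h1 - e0 - 4 * k₁ * k₂ * h2
    obtain ⟨h1, h2⟩ := expBinomial_coeff_eq (A := 2 * k₁ * -κ) (B := 2 * k₂ * -κ) (C := p₁)
      (D := p₂) fun z => by
        rw [← heq, hfk, hdk]
        have := hE z
        simp only [one_mul, neg_mul] at this ⊢
        linear_combination -4 * k₁ * k₂ * this - hkk
    refine ⟨k₁, k₂, -κ, ?_, h1, h2, fun z => ?_⟩
    · rw [← h1, ← h2]; linear_combination κ ^ 2 * hkk
    · simpa using hfk z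
  · obtain rfl : ν = 1 / 4 := by linear_combination h / 4
    obtain rfl : κ = 0 := by linear_combination e1 / 6
    have hC1 := hC0 rfl
    obtain rfl : a = 4 := by
      refine mul_left_cancel₀ hC1 ?_
      linear_combination -2 * e0
    refine .inr ⟨rfl, ?_⟩
    obtain ⟨k₁, k₂, hk⟩ := eq_add_exp_of_deriv_deriv_eq hf (r := 1 / 2) (s := -(1 / 2))
      (by norm_num) fun z => by rw [hκ']; ring
    obtain ⟨h1, h2⟩ := expBinomial_coeff_eq (A := 2 * k₁ ^ 2) (B := 2 * k₂ ^ 2) (C := p₁)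
      (D := p₂) fun z => by
        rw [← heq, funext hk, (hasDerivAt_add_exp _ _ _ _ _).deriv, exp_eq_exp_half_sq z,
          exp_eq_exp_half_sq (-z), show (1 / 2 * -z : ℂ) = -(1 / 2) * z by ring]
        ring
    exact ⟨k₁, k₂, by rw [← h1]; ring, by rw [← h2]; ring, hk⟩

/-- In the exceptional case the equation of third order factors. -/
theorem exceptional_factor {p₁ p₂ : ℂ} (hp₁ : p₁ ≠ 0) {f : ℂ → ℂ} (hf : Differentiable ℂ f)
    (heq : ∀ z, f z ^ 2 + -(4 / 9) * deriv f z ^ 2 = p₁ * exp z + p₂ * exp (-z)) :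
    (∀ z, deriv (deriv f) z = -deriv f z + 3 / 4 * f z) ∨
      ∀ z, deriv (deriv f) z = deriv f z + 3 / 4 * f z := by
  have d0 := fun z => (hf z).hasDerivAt
  have d1 := fun z => (hf.deriv z).hasDerivAt
  have d2 := fun z => (hf.deriv.deriv z).hasDerivAt
  have dm₁ := fun z => ((d2 z).add (d1 z)).sub ((d0 z).const_mul (3 / 4))
  have de : ∀ z, HasDerivAt (fun z => exp (4 * z)) (4 * exp (4 * z)) z := fun z => by
    simpa [mul_comm] using ((hasDerivAt_id z).const_mul 4).cexp
  have dm₂ := fun z => (((d2 z).sub (d1 z)).sub ((d0 z).const_mul (3 / 4))).mul (de z)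
  by_cases h : ∀ z, deriv (deriv f) z + deriv f z - 3 / 4 * f z = 0
  · exact .inl fun z => by linear_combination h z
  right
  push Not at h
  obtain ⟨c, hc⟩ := h
  obtain ⟨C, hC⟩ := exists_const_mul_of_wronskian_eq_zero
    (u := fun z => (deriv (deriv f) z - deriv f z - 3 / 4 * f z) * exp (4 * z))
    (v := fun z => deriv (deriv f) z + deriv f z - 3 / 4 * f z)
    (fun z => (dm₂ z).differentiableAt) (fun z => (dm₁ z).differentiableAt) hc fun z => by
      have e1 := (dm₁ z).deriv
      have e2 := (dm₂ z).deriv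
      refine (congrArg (· * _) e2).trans (Eq.trans ?_ (congrArg (_ * ·) e1).symm)
      simp only [Pi.sub_apply]
      linear_combination (-9 / 4) * exp (4 * z) * quadratic_ode hf heq z
  rcases eq_or_ne C 0 with rfl | hC0
  · intro z
    have := (mul_eq_zero.1 ((hC z).trans (zero_mul _))).resolve_right (Complex.exp_ne_zero _)
    linear_combination this
  · exfalso
    have hzero : ∀ z, exp (4 * z) = C → p₁ * exp z - p₂ * exp (-z) = 0 := fun z hz => by
      have h1 := hC z
      simp only [hz] at h1
      have h2 : deriv f z = 0 := by
        refine mul_left_cancel₀ hC0 ?_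
        linear_combination -h1 / 2
      have h3 := deriv_eq_of_eq (m := 0) hf heq z
      rw [h2] at h3
      simpa using h3.symm
    have hlog : exp (4 * (Complex.log C / 4)) = C := by
      rw [mul_div_cancel₀ _ (by norm_num : (4 : ℂ) ≠ 0), Complex.exp_log hC0]
    have h1 := hzero _ hlog
    have h2 := hzero (Complex.log C / 4 + Real.pi / 2 * I) (by
      rw [mul_add, Complex.exp_add, hlog, show (4 * (Real.pi / 2 * I) : ℂ) = 2 * Real.pi * I by ring,
        Complex.exp_two_pi_mul_I, mul_one])
    rw [neg_add, Complex.exp_add, Complex.exp_add, Complex.exp_neg (Real.pi / 2 * I),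
      Complex.exp_pi_div_two_mul_I, Complex.inv_I] at h2
    refine expBinomial_not_both_zero hp₁ (mul_left_cancel₀ Complex.I_ne_zero ?_) h1
    linear_combination h2

theorem exp_three_halves (z : ℂ) : exp (3 / 2 * z) = exp (1 / 2 * z) ^ 3 := by
  rw [← Complex.exp_nat_mul]; push_cast; ring_nf

theorem quadratic_solution_of_exceptional {p₁ p₂ : ℂ} (hp₁ : p₁ ≠ 0) (hp₂ : p₂ ≠ 0) {f : ℂ → ℂ}
    (hf : Differentiable ℂ f)
    (heq : ∀ z, f z ^ 2 + -(4 / 9) * deriv f z ^ 2 = p₁ * exp z + p₂ * exp (-z)) :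
    (∃ l₁ l₂ : ℂ, l₂ ^ 2 = 9 / 8 * p₁ ∧ l₁ ^ 2 = p₂ ^ 2 / (8 * p₁) ∧
      ∀ z, f z = l₁ * exp (-(3 / 2) * z) + l₂ * exp (1 / 2 * z)) ∨
    (∃ l₃ l₄ : ℂ, l₄ ^ 2 = 9 / 8 * p₂ ∧ l₃ ^ 2 = p₁ ^ 2 / (8 * p₂) ∧
      ∀ z, f z = l₃ * exp (3 / 2 * z) + l₄ * exp (-(1 / 2) * z)) := by
  have e1 := exp_half_mul_exp_neg_half
  have e2 := exp_eq_exp_half_sq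
  have e3 := exp_three_halves
  have e4 : ∀ z, exp (-z) = exp (-(1 / 2) * z) ^ 2 := fun z => by
    rw [e2, mul_neg, neg_mul]
  have e5 : ∀ z, exp (-(3 / 2) * z) = exp (-(1 / 2) * z) ^ 3 := fun z => by
    rw [neg_mul, ← mul_neg, e3, mul_neg, neg_mul]
  rcases exceptional_factor hp₁ hf heq with h | h
  · left
    obtain ⟨A, B, hk⟩ := eq_add_exp_of_deriv_deriv_eq hf (r := -(3 / 2)) (s := 1 / 2)
      (by norm_num) fun z => by rw [h]; ring
    obtain ⟨h1, h2⟩ := expBinomial_coeff_eq (A := 8 / 9 * B ^ 2) (B := 8 / 3 * A * B) (C := p₁)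
      (D := p₂) fun z => by
        rw [← heq, funext hk, (hasDerivAt_add_exp _ _ _ _ _).deriv, e4, e2]
        simp only [e5]
        linear_combination (-8 / 3) * A * B * exp (-(1 / 2) * z) ^ 2 * e1 z
    have hB : B ≠ 0 := fun h => hp₁ (by rw [← h1, h]; ring)
    refine ⟨A, B, by rw [← h1]; ring, ?_, hk⟩
    rw [← h1, ← h2]
    field_simp
    norm_num
  · right
    obtain ⟨A, B, hk⟩ := eq_add_exp_of_deriv_deriv_eq hf (r := 3 / 2) (s := -(1 / 2))
      (by norm_num) fun z => by rw [h]; ring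
    obtain ⟨h1, h2⟩ := expBinomial_coeff_eq (A := 8 / 3 * A * B) (B := 8 / 9 * B ^ 2) (C := p₁)
      (D := p₂) fun z => by
        rw [← heq, funext hk, (hasDerivAt_add_exp _ _ _ _ _).deriv, e4, e2]
        simp only [e3]
        linear_combination (-8 / 3) * A * B * exp (1 / 2 * z) ^ 2 * e1 z
    have hB : B ≠ 0 := fun h => hp₂ (by rw [← h2, h]; ring)
    refine ⟨A, B, by rw [← h2]; ring, ?_, hk⟩
    rw [← h1, ← h2]
    field_simp
    norm_num

theorem exists_rescaling {n : ℕ} {a p₁ p₂ b : ℂ} (hb : b ≠ 0) {f : ℂ → ℂ} (hf : Differentiable ℂ f)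
    (heq : ∀ z, f z ^ n + a * deriv f z ^ n = p₁ * exp (b * z) + p₂ * exp (-b * z)) :
    ∃ F : ℂ → ℂ, Differentiable ℂ F ∧ (∀ z, f z = F (b * z)) ∧
      ∀ z, F z ^ n + a * b ^ n * deriv F z ^ n = p₁ * exp z + p₂ * exp (-z) := by
  have hd : ∀ z, HasDerivAt (fun z => f (z / b)) (deriv f (z / b) * (1 / b)) z := fun z =>
    HasDerivAt.comp z (hf (z / b)).hasDerivAt ((hasDerivAt_id z).div_const b)
  refine ⟨fun z => f (z / b), fun z => (hd z).differentiableAt, fun z => ?_, fun z => ?_⟩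
  · simp only [mul_div_cancel_left₀ z hb]
  · rw [(hd z).deriv, mul_pow, mul_assoc, mul_left_comm (b ^ n), ← mul_pow b, mul_one_div_cancel hb,
      one_pow, mul_one, heq, neg_mul, mul_div_cancel₀ z hb]

theorem stmt_0 (n : ℕ) (hn2 : 2 ≤ n) (hn4 : n ≤ 4)
    (a p₁ p₂ b : ℂ) (ha : a ≠ 0) (hp₁ : p₁ ≠ 0) (hp₂ : p₂ ≠ 0) (hb : b ≠ 0)
    (f : ℂ → ℂ) (hf : Differentiable ℂ f)
    (heq : ∀ z : ℂ, f z ^ n + a * (deriv f z) ^ n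
        = p₁ * Complex.exp (b * z) + p₂ * Complex.exp (-b * z)) :
    (n = 2 ∨ n = 4) ∧
    (n = 4 → ∃ k₁ k₂ : ℂ,
      (∀ z : ℂ, f z = k₁ * Complex.exp (b / 2 * z) + k₂ * Complex.exp (-(b / 2) * z)) ∧
      a * (b / 2) ^ 4 = -1 ∧ 8 * k₁ ^ 3 * k₂ = p₁ ∧ 8 * k₂ ^ 3 * k₁ = p₂) ∧
    (n = 2 → 9 * a * b ^ 2 ≠ -4 →
      ((a * b ^ 2 + 1 = 0 ∧ ∃ t₁ t₂ r : ℂ,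
          r ^ 4 = -(p₁ * p₂) ∧ 2 * t₁ * r = p₁ ∧ 2 * t₂ * r = p₂ ∧
          ∀ z : ℂ, f z = t₁ * Complex.exp (b * z) + t₂ * Complex.exp (-b * z) + r) ∨
       (a * b ^ 2 - 4 = 0 ∧ ∃ l₁ l₂ : ℂ,
          l₁ ^ 2 = p₁ / 2 ∧ l₂ ^ 2 = p₂ / 2 ∧
          ∀ z : ℂ, f z = l₁ * Complex.exp (b / 2 * z) + l₂ * Complex.exp (-(b / 2) * z)))) ∧
    (n = 2 → 9 * a * b ^ 2 = -4 →
      ((∃ l₁ l₂ : ℂ, l₂ ^ 2 = 9 / 8 * p₁ ∧ l₁ ^ 2 = p₂ ^ 2 / (8 * p₁) ∧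
          ∀ z : ℂ, f z = l₁ * Complex.exp (-(3 * b / 2) * z) + l₂ * Complex.exp (b / 2 * z)) ∨
       (∃ l₃ l₄ : ℂ, l₄ ^ 2 = 9 / 8 * p₂ ∧ l₃ ^ 2 = p₁ ^ 2 / (8 * p₂) ∧
          ∀ z : ℂ, f z = l₃ * Complex.exp (3 * b / 2 * z) + l₄ * Complex.exp (-(b / 2) * z)))) := by
  obtain ⟨F, hF, hfF, hFeq⟩ := exists_rescaling hb hf heq
  have hab : a * b ^ n ≠ 0 := mul_ne_zero ha (pow_ne_zero n hb)
  obtain rfl | rfl | rfl : n = 2 ∨ n = 3 ∨ n = 4 := by omega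
  · refine ⟨.inl rfl, by omega, fun _ h9 => ?_, fun _ h9 => ?_⟩
    · rcases quadratic_solution hab (by rwa [← mul_assoc]) hp₁ hp₂ hF hFeq with
        ⟨h, t₁, t₂, r, h1, h2, h3, hk⟩ | ⟨h, l₁, l₂, h1, h2, hk⟩
      · refine .inl ⟨by rw [h]; ring, t₁, t₂, r, h1, h2, h3, fun z => ?_⟩
        rw [hfF, hk, neg_mul]
      · refine .inr ⟨by rw [h]; ring, l₁, l₂, h1, h2, fun z => ?_⟩
        rw [hfF, hk]; ring_nf
    · rw [show a * b ^ 2 = -(4 / 9) by linear_combination h9 / 9] at hFeq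
      rcases quadratic_solution_of_exceptional hp₁ hp₂ hF hFeq with ⟨l₁, l₂, h1, h2, hk⟩ | ⟨l₁, l₂, h1, h2, hk⟩
      · exact .inl ⟨l₁, l₂, h1, h2, fun z => by rw [hfF, hk]; ring_nf⟩
      · exact .inr ⟨l₁, l₂, h1, h2, fun z => by rw [hfF, hk]; ring_nf⟩
  · exact (not_cubic_solution hab hp₁ hp₂ hF hFeq).elim
  · refine ⟨.inr rfl, fun _ => ?_, by omega, by omega⟩
    obtain ⟨h, k₁, k₂, hk, h1, h2⟩ := quartic_solution hab hp₁ hp₂ hF hFeq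
    exact ⟨k₁, k₂, fun z => by rw [hfF, hk]; ring_nf, by linear_combination h / 16, h1, h2⟩
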